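/- Fix p ∈ (0,1), α with 0 < α < 1/(1+p), and a grading exponent q > 4/α. For each n ≥ 1 let π_h be the piecewise-constant mean-value projection on the graded mesh with nodes t_i = (i/n)^q. Then there is a constant C, independent of n and u, such that for every u ∈ C⁴_α, sup_{x ∈ (0,1]} |(K(I − π_h)K(I − π_h)u)(x)| ≤ C·n^{−4}·‖u‖_{4,α}. -/

import Mathlib

open MeasureTheory Real

/-- The double-layer corner kernel
`k(x,y) = (sin(pπ)/π)·x/(x² + y² + 2xy·cos(pπ))` for a corner of interior angle
`(1−p)π`. -/
noncomputable def cornerKernel (p x y : ℝ) : ℝ :=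
  Real.sin (p * Real.pi) / Real.pi * x / (x ^ 2 + y ^ 2 + 2 * x * y * Real.cos (p * Real.pi))

/-- The corner operator `(Ku)(x) = ∫₀¹ k(x,y)·u(y) dy`. -/
noncomputable def cornerOp (p : ℝ) (u : ℝ → ℝ) (x : ℝ) : ℝ :=
  ∫ y in Set.Ioc (0 : ℝ) 1, cornerKernel p x y * u y

/-- Node `t_i = (i/n)^q` of the graded mesh on `[0,1]` with grading exponent `q`. -/
noncomputable def gradedNode (n : ℕ) (q : ℝ) (i : ℕ) : ℝ :=
  ((i : ℝ) / (n : ℝ)) ^ q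

/-- The piecewise-constant mean-value (Galerkin) projection `π_h` on the graded mesh:
on each subinterval `τ_i = (t_{i−1}, t_i]` the function is replaced by its mean value. -/
noncomputable def gradedProj (n : ℕ) (q : ℝ) (u : ℝ → ℝ) (x : ℝ) : ℝ :=
  ∑ i ∈ Finset.Icc 1 n,
    Set.indicator (Set.Ioc (gradedNode n q (i - 1)) (gradedNode n q i))
      (fun _ => (gradedNode n q i - gradedNode n q (i - 1))⁻¹ *
        ∫ y in Set.Ioc (gradedNode n q (i - 1)) (gradedNode n q i), u y) x

/-- The set of weighted values whose supremum is the weighted norm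
`‖u‖_{m,α} = max_{0≤i≤m} sup_{t∈(0,1]} t^{max(i−α,0)}·|u^{(i)}(t)|`, with derivatives
taken within `(0,1]`. -/
def weightedSet (m : ℕ) (α : ℝ) (u : ℝ → ℝ) : Set ℝ :=
  {r : ℝ | ∃ i ≤ m, ∃ t ∈ Set.Ioc (0 : ℝ) 1,
    r = t ^ max ((i : ℝ) - α) 0 * |iteratedDerivWithin i u (Set.Ioc 0 1) t|}

/-- The weighted norm `‖u‖_{m,α}`. -/
noncomputable def weightedNorm (m : ℕ) (α : ℝ) (u : ℝ → ℝ) : ℝ :=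
  sSup (weightedSet m α u)

/-- `K(I − π_h)u`, the corner operator applied to the projection error of `u`. -/
noncomputable def cornerErr (p q : ℝ) (n : ℕ) (u : ℝ → ℝ) : ℝ → ℝ :=
  fun x => cornerOp p (fun y => u y - gradedProj n q u y) x

lemma node_zero {n : ℕ} {q : ℝ} (hq : 1 ≤ q) : gradedNode n q 0 = 0 := by
  simp [gradedNode, Real.zero_rpow (by linarith : q ≠ 0)]

lemma node_n {n : ℕ} {q : ℝ} (hn : 1 ≤ n) : gradedNode n q n = 1 := by
  have : (n : ℝ) ≠ 0 := by positivity
  simp [gradedNode, this]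

lemma node_pos {n : ℕ} {q : ℝ} (hn : 1 ≤ n) (j : ℕ) : 0 < gradedNode n q (j + 1) := by
  unfold gradedNode
  have : (0 : ℝ) < n := by positivity
  positivity

lemma node_nonneg {n : ℕ} {q : ℝ} (j : ℕ) : 0 ≤ gradedNode n q j := by
  unfold gradedNode
  positivity

lemma node_mono {n : ℕ} {q : ℝ} (hq : 1 ≤ q) {i j : ℕ} (h : i ≤ j) :
    gradedNode n q i ≤ gradedNode n q j := by
  unfold gradedNode
  gcongr

lemma node_strict {n : ℕ} {q : ℝ} (hn : 1 ≤ n) (hq : 1 ≤ q) (j : ℕ) :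
    gradedNode n q j < gradedNode n q (j + 1) := by
  unfold gradedNode
  have : (0 : ℝ) < n := by positivity
  apply Real.rpow_lt_rpow (by positivity) _ (by linarith)
  gcongr
  simp

lemma node_le_one {n : ℕ} {q : ℝ} (hn : 1 ≤ n) (hq : 1 ≤ q) {j : ℕ} (h : j ≤ n) :
    gradedNode n q j ≤ 1 := by
  rw [← node_n (q := q) hn]; exact node_mono hq h

lemma node_h {n : ℕ} {q : ℝ} (hn : 1 ≤ n) (hq : 1 ≤ q) (j : ℕ) :
    gradedNode n q (j + 1) - gradedNode n q j ≤ q * gradedNode n q (j + 1) / ((j : ℝ) + 1) := by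
  have hn' : (0 : ℝ) < n := by positivity
  have hj : (0 : ℝ) < (j : ℝ) + 1 := by positivity
  have h1 := one_add_mul_self_le_rpow_one_add (s := -(1 / ((j : ℝ) + 1))) (p := q)
    (by have : 1 / ((j : ℝ) + 1) ≤ 1 := by
          rw [div_le_one hj]; linarith [(Nat.cast_nonneg j : (0 : ℝ) ≤ j)]
        linarith) hq
  have h2 : gradedNode n q j = gradedNode n q (j + 1) * (1 + -(1 / ((j : ℝ) + 1))) ^ q := by
    have e : (1 + -(1 / ((j : ℝ) + 1))) = (j : ℝ) / (j + 1) := by field_simp; ring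
    rw [e]
    unfold gradedNode
    rw [← Real.mul_rpow (by positivity) (by positivity)]
    congr 1
    push_cast
    field_simp
  have h3 := mul_le_mul_of_nonneg_left h1 (node_nonneg (n := n) (q := q) (j + 1))
  rw [← h2] at h3
  have h4 : gradedNode n q (j + 1) * (1 + q * -(1 / ((j : ℝ) + 1)))
    = gradedNode n q (j + 1) - q * gradedNode n q (j + 1) / ((j : ℝ) + 1) := by ring
  linarith

lemma node_dbl {n : ℕ} {q : ℝ} (hn : 1 ≤ n) (hq : 1 ≤ q) (j : ℕ) :
    gradedNode n q (j + 2) ≤ 2 ^ q * gradedNode n q (j + 1) := by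
  unfold gradedNode
  rw [← Real.mul_rpow (by positivity) (by positivity)]
  apply Real.rpow_le_rpow (by positivity) _ (by linarith)
  rw [← mul_div_assoc]
  gcongr
  push_cast
  linarith [(Nat.cast_nonneg j : (0 : ℝ) ≤ j)]

lemma node_pow {n : ℕ} {q : ℝ} (hn : 1 ≤ n) (hq : 1 ≤ q) (j : ℕ) (b : ℝ) :
    ((n : ℝ) ^ 2)⁻¹ * gradedNode n q (j + 1) ^ (b - 2 / q) =
      (((j : ℝ) + 1) ^ 2)⁻¹ * gradedNode n q (j + 1) ^ b := by
  have hn' : (0 : ℝ) < n := by positivity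
  rw [Real.rpow_sub (node_pos hn j)]
  have : gradedNode n q (j + 1) ^ (2 / q) = (((j : ℝ) + 1) / n) ^ 2 := by
    unfold gradedNode
    rw [← Real.rpow_mul (by positivity), mul_div_cancel₀ _ (by linarith : q ≠ 0)]
    push_cast
    norm_cast
  rw [this]
  field_simp

/-- Each mesh interval. -/
def cell (n : ℕ) (q : ℝ) (j : ℕ) : Set ℝ :=
  Set.Ioc (gradedNode n q j) (gradedNode n q (j + 1))

lemma cell_sub {n : ℕ} {q : ℝ} (hn : 1 ≤ n) (hq : 1 ≤ q) {j : ℕ} (h : j < n) :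
    cell n q j ⊆ Set.Ioc 0 1 := by
  intro y hy
  exact ⟨(node_nonneg j).trans_lt hy.1, hy.2.trans (node_le_one hn hq h)⟩

lemma cell_cover {n : ℕ} {q : ℝ} (hn : 1 ≤ n) (hq : 1 ≤ q) {x : ℝ} (hx : x ∈ Set.Ioc (0 : ℝ) 1) :
    ∃ j < n, x ∈ cell n q j := by
  have hex : ∃ j, x ≤ gradedNode n q j := ⟨n, by rw [node_n hn]; exact hx.2⟩
  classical
  have h1 := Nat.find_spec hex
  have hne : Nat.find hex ≠ 0 := by
    intro h0
    rw [h0, node_zero hq] at h1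
    linarith [hx.1]
  obtain ⟨j, hj⟩ := Nat.exists_eq_succ_of_ne_zero hne
  refine ⟨j, ?_, ?_, ?_⟩
  · have : Nat.find hex ≤ n := Nat.find_min' hex (by rw [node_n hn]; exact hx.2)
    omega
  · have := Nat.find_min hex (m := j) (by omega)
    linarith
  · rw [hj] at h1; exact h1

lemma cell_proj {n : ℕ} {q : ℝ} (hn : 1 ≤ n) (hq : 1 ≤ q) {j : ℕ} (h : j < n) (w : ℝ → ℝ)
    {x : ℝ} (hx : x ∈ cell n q j) :
    gradedProj n q w x = (gradedNode n q (j + 1) - gradedNode n q j)⁻¹ *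
      ∫ y in cell n q j, w y := by
  unfold gradedProj
  rw [Finset.sum_eq_single (j + 1)]
  · rw [Set.indicator_of_mem]
    · simp [cell]
    · simpa [cell] using hx
  · intro i hi hij
    rw [Finset.mem_Icc] at hi
    apply Set.indicator_of_notMem
    rintro ⟨h1, h2⟩
    rcases lt_or_gt_of_ne hij with h3 | h3
    · have := node_mono (n := n) hq (show i ≤ j by omega)
      linarith [hx.1]
    · have := node_mono (n := n) hq (show j + 1 ≤ i - 1 by omega)
      linarith [hx.2]
  · intro h1
    exfalso; apply h1; rw [Finset.mem_Icc]; omega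

lemma cell_sum {n : ℕ} {q : ℝ} (hn : 1 ≤ n) (hq : 1 ≤ q) {f : ℝ → ℝ}
    (hf : IntegrableOn f (Set.Ioc 0 1)) :
    ∫ y in Set.Ioc (0 : ℝ) 1, f y = ∑ j ∈ Finset.range n, ∫ y in cell n q j, f y := by
  have h1 : ∀ k < n, IntervalIntegrable f volume (gradedNode n q k) (gradedNode n q (k + 1)) := by
    intro k hk
    rw [intervalIntegrable_iff_integrableOn_Ioc_of_le (node_strict hn hq k).le]
    exact hf.mono_set (cell_sub hn hq hk)
  have h2 := intervalIntegral.sum_integral_adjacent_intervals h1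
  rw [node_zero hq, node_n hn, intervalIntegral.integral_of_le zero_le_one] at h2
  rw [← h2]
  refine Finset.sum_congr rfl fun k _ => ?_
  rw [intervalIntegral.integral_of_le (node_strict hn hq k).le]
  rfl

/-- Oscillation hypothesis. -/
def Hosc (n : ℕ) (q β M : ℝ) (w : ℝ → ℝ) : Prop :=
  ∀ j < n, ∀ y ∈ cell n q j, ∀ z ∈ cell n q j, |w y - w z| ≤
    M * (gradedNode n q (j + 1) - gradedNode n q j) * gradedNode n q (j + 1) ^ (β - 1)

lemma vol_cell {n : ℕ} {q : ℝ} (hn : 1 ≤ n) (hq : 1 ≤ q) (j : ℕ) :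
    volume.real (cell n q j) = gradedNode n q (j + 1) - gradedNode n q j := by
  unfold cell
  rw [Real.volume_real_Ioc_of_le (node_strict hn hq j).le]

lemma err_mean {n : ℕ} {q : ℝ} (hn : 1 ≤ n) (hq : 1 ≤ q) {w : ℝ → ℝ}
    (hw : IntegrableOn w (Set.Ioc 0 1)) {j : ℕ} (h : j < n) :
    IntegrableOn (fun y => w y - gradedProj n q w y) (cell n q j) ∧
    ∫ y in cell n q j, (w y - gradedProj n q w y) = 0 := by
  have hms : MeasurableSet (cell n q j) := measurableSet_Ioc
  have hwi := hw.mono_set (cell_sub hn hq h)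
  set c := (gradedNode n q (j + 1) - gradedNode n q j)⁻¹ * ∫ y in cell n q j, w y with hc
  have hci : IntegrableOn (fun _ : ℝ => c) (cell n q j) :=
    integrableOn_const (by simp [cell])
  have heq : Set.EqOn (fun y => w y - gradedProj n q w y) (fun y => w y - c) (cell n q j) := by
    intro y hy
    simp only [cell_proj hn hq h w hy, hc]
  constructor
  · exact (hwi.sub hci).congr_fun heq.symm hms
  · rw [setIntegral_congr_fun hms heq, integral_sub hwi hci, setIntegral_const, vol_cell hn hq,
      smul_eq_mul, hc, mul_inv_cancel_left₀ (by linarith [node_strict hn hq j (n := n)]), sub_self]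

lemma err_int {n : ℕ} {q : ℝ} (hn : 1 ≤ n) (hq : 1 ≤ q) {w : ℝ → ℝ}
    (hw : IntegrableOn w (Set.Ioc 0 1)) :
    IntegrableOn (fun y => w y - gradedProj n q w y) (Set.Ioc 0 1) := by
  have : Set.Ioc (0 : ℝ) 1 = ⋃ j ∈ Finset.range n, cell n q j := by
    ext x
    simp only [Set.mem_iUnion, Finset.mem_range, exists_prop]
    constructor
    · exact fun hx => cell_cover hn hq hx
    · rintro ⟨j, hj, hx⟩; exact cell_sub hn hq hj hx
  rw [this, integrableOn_finset_iUnion]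
  intro j hj
  exact (err_mean hn hq hw (Finset.mem_range.1 hj)).1

lemma err_bound {n : ℕ} {q β M : ℝ} (hn : 1 ≤ n) (hq : 1 ≤ q) {w : ℝ → ℝ}
    (hw : IntegrableOn w (Set.Ioc 0 1)) (hH : Hosc n q β M w) {j : ℕ} (h : j < n)
    {y : ℝ} (hy : y ∈ cell n q j) :
    |w y - gradedProj n q w y| ≤
      M * (gradedNode n q (j + 1) - gradedNode n q j) * gradedNode n q (j + 1) ^ (β - 1) := by
  have hms : MeasurableSet (cell n q j) := measurableSet_Ioc
  have hpos : 0 < gradedNode n q (j + 1) - gradedNode n q j := by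
    linarith [node_strict hn hq j (n := n)]
  have hwi := hw.mono_set (cell_sub hn hq h)
  have hci : IntegrableOn (fun _ : ℝ => w y) (cell n q j) :=
    integrableOn_const (by simp [cell])
  have e : w y - gradedProj n q w y =
      (gradedNode n q (j + 1) - gradedNode n q j)⁻¹ * ∫ z in cell n q j, (w y - w z) := by
    rw [cell_proj hn hq h w hy, integral_sub hci hwi, setIntegral_const, vol_cell hn hq,
      smul_eq_mul, mul_sub, inv_mul_cancel_left₀ hpos.ne']
  have b := norm_setIntegral_le_of_norm_le_const (μ := volume) (s := cell n q j)
    (f := fun z => w y - w z) (by simp [cell]) (fun z hz => hH j h y hy z hz)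
  rw [vol_cell hn hq, Real.norm_eq_abs] at b
  rw [e, abs_mul, abs_of_pos (inv_pos.2 hpos)]
  calc _ ≤ _ := mul_le_mul_of_nonneg_left b (inv_pos.2 hpos).le
    _ = _ := by field_simp

/-- Bound on one cell, using the mean-zero property. -/
lemma cell_bound {n : ℕ} {q β M B : ℝ} (hn : 1 ≤ n) (hq : 1 ≤ q) {w g : ℝ → ℝ}
    (hw : IntegrableOn w (Set.Ioc 0 1)) (hH : Hosc n q β M w) {j : ℕ} (h : j < n)
    (hg : ContinuousOn g (Set.Icc 0 1))
    (hB : ∀ y ∈ cell n q j, |g y - g (gradedNode n q (j + 1))| ≤ B) :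
    |∫ y in cell n q j, g y * (w y - gradedProj n q w y)| ≤
      B * (M * (gradedNode n q (j + 1) - gradedNode n q j) * gradedNode n q (j + 1) ^ (β - 1)) *
      (gradedNode n q (j + 1) - gradedNode n q j) := by
  obtain ⟨hi, h0⟩ := err_mean hn hq hw h
  have hms : MeasurableSet (cell n q j) := measurableSet_Ioc
  set e := fun y => w y - gradedProj n q w y with he
  have hI : IntegrableOn (fun y => g y * e y) (cell n q j) := by
    have hsub : Set.Icc (gradedNode n q j) (gradedNode n q (j + 1)) ⊆ Set.Icc 0 1 :=
      Set.Icc_subset_Icc (node_nonneg j) (node_le_one hn hq h)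
    obtain ⟨A, hA⟩ := isCompact_Icc.exists_bound_of_continuousOn (hg.mono hsub)
    refine Integrable.bdd_mul (c := A) hi ?_ ?_
    · exact ((hg.mono hsub).mono Set.Ioc_subset_Icc_self).aestronglyMeasurable hms
    · filter_upwards [ae_restrict_mem hms] with y hy
      exact hA y (Set.Ioc_subset_Icc_self hy)
  have e1 : ∫ y in cell n q j, g y * e y =
      ∫ y in cell n q j, (g y - g (gradedNode n q (j + 1))) * e y := by
    simp_rw [sub_mul]
    rw [integral_sub hI (hi.const_mul _), integral_const_mul, h0]
    simp
  rw [e1, ← vol_cell hn hq, ← Real.norm_eq_abs]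
  refine norm_setIntegral_le_of_norm_le_const (by simp [cell]) ?_
  intro y hy
  rw [norm_mul]
  exact mul_le_mul (hB y hy) (by rw [vol_cell hn hq]; exact err_bound hn hq hw hH h hy) (norm_nonneg _)
    ((abs_nonneg _).trans (hB y hy))

lemma sum_min (i n : ℕ) (f : ℕ → ℝ) (h1 : ∀ j, f j ≤ (((i : ℝ) + 1) ^ 3)⁻¹)
    (h2 : ∀ j, f j ≤ (((j : ℝ) + 1) ^ 3)⁻¹) :
    ∑ j ∈ Finset.range n, f j ≤ 2 * (((i : ℝ) + 1) ^ 2)⁻¹ := by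
  have ha : (0 : ℝ) < (i : ℝ) + 1 := by positivity
  have A : ∀ m : ℕ, ∑ j ∈ Finset.range m, f j ≤ m * (((i : ℝ) + 1) ^ 3)⁻¹ := by
    intro m
    calc _ ≤ ∑ j ∈ Finset.range m, (((i : ℝ) + 1) ^ 3)⁻¹ := Finset.sum_le_sum fun j _ => h1 j
      _ = _ := by simp
  have B : ∀ k : ℕ, ∑ j ∈ Finset.range (i + 1 + k), f j ≤
      2 * (((i : ℝ) + 1) ^ 2)⁻¹ - ((i : ℝ) + 1)⁻¹ * ((i : ℝ) + 1 + k)⁻¹ := by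
    intro k
    induction k with
    | zero =>
      refine (A _).trans (le_of_eq ?_)
      push_cast
      field_simp
      ring
    | succ k ih =>
      rw [← add_assoc, Finset.sum_range_succ]
      have h3 := h2 (i + 1 + k)
      push_cast at h3 ⊢
      have hk : (0 : ℝ) ≤ k := by positivity
      have hb : (0 : ℝ) < (i : ℝ) + 1 + k := by positivity
      have h4 : (((i : ℝ) + 1 + k + 1) ^ 3)⁻¹ ≤
          ((i : ℝ) + 1)⁻¹ * (((i : ℝ) + 1 + k) * ((i : ℝ) + 1 + k + 1))⁻¹ := by
        rw [← mul_inv]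
        apply inv_anti₀ (by positivity)
        calc ((i : ℝ) + 1) * (((i : ℝ) + 1 + k) * ((i : ℝ) + 1 + k + 1))
            ≤ ((i : ℝ) + 1 + k + 1) * (((i : ℝ) + 1 + k + 1) * ((i : ℝ) + 1 + k + 1)) := by
              exact mul_le_mul (by linarith) (mul_le_mul_of_nonneg_right (by linarith)
                (by positivity)) (by positivity) (by positivity)
          _ = _ := by ring
      have h5 : ((i : ℝ) + 1)⁻¹ * (((i : ℝ) + 1 + k) * ((i : ℝ) + 1 + k + 1))⁻¹ =
          ((i : ℝ) + 1)⁻¹ * ((i : ℝ) + 1 + k)⁻¹ - ((i : ℝ) + 1)⁻¹ * ((i : ℝ) + 1 + (k + 1))⁻¹ := by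
        field_simp
        ring
      linarith
  rcases le_total n (i + 1) with h | h
  · refine (A n).trans ?_
    have : (n : ℝ) ≤ i + 1 := by exact_mod_cast h
    calc (n : ℝ) * (((i : ℝ) + 1) ^ 3)⁻¹ ≤ (i + 1) * (((i : ℝ) + 1) ^ 3)⁻¹ := by gcongr
      _ = (((i : ℝ) + 1) ^ 2)⁻¹ := by field_simp
      _ ≤ _ := by
        have : 0 < (((i : ℝ) + 1) ^ 2)⁻¹ := by positivity
        linarith
  · obtain ⟨k, rfl⟩ := Nat.exists_eq_add_of_le h
    refine (B k).trans ?_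
    have : 0 < ((i : ℝ) + 1)⁻¹ * ((i : ℝ) + 1 + k)⁻¹ := by positivity
    linarith

lemma mesh_sum {n : ℕ} {q β : ℝ} (hn : 1 ≤ n) (hq : 4 ≤ q) (hβ0 : 0 ≤ β) (hβ1 : β ≤ 1) (i : ℕ) :
    ∑ j ∈ Finset.range n, (gradedNode n q (j + 1) - gradedNode n q j) ^ 3 *
      gradedNode n q (j + 1) ^ (β - 1) / (gradedNode n q (i + 1) + gradedNode n q (j + 1)) ^ 3 ≤
    2 * q ^ 3 * (((n : ℝ) ^ 2)⁻¹ * gradedNode n q (i + 1) ^ (β - 1 - 2 / q)) := by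
  have hq1 : 1 ≤ q := by linarith
  rw [node_pow hn hq1]
  set a := gradedNode n q (i + 1) with ha
  have hapos : 0 < a := node_pos hn i
  have key : ∀ j : ℕ, (gradedNode n q (j + 1) - gradedNode n q j) ^ 3 *
      gradedNode n q (j + 1) ^ (β - 1) / (a + gradedNode n q (j + 1)) ^ 3 ≤
      q ^ 3 * a ^ (β - 1) * min (((i : ℝ) + 1) ^ 3)⁻¹ (((j : ℝ) + 1) ^ 3)⁻¹ := by
    intro j
    have hbpos : 0 < gradedNode n q (j + 1) := node_pos hn j
    have hh := node_h hn hq1 j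
    have hh0 := node_strict hn hq1 j (n := n)
    have hj : (0 : ℝ) < (j : ℝ) + 1 := by positivity
    have hi : (0 : ℝ) < (i : ℝ) + 1 := by positivity
    have hjn : (0 : ℝ) < n := by positivity
    have s1 : (gradedNode n q (j + 1) - gradedNode n q j) ^ 3 ≤
      (q * gradedNode n q (j + 1) / ((j : ℝ) + 1)) ^ 3 := by
      gcongr
    rcases le_total i j with h | h
    · have hij : (i : ℝ) ≤ j := by exact_mod_cast h
      rw [min_eq_right (by gcongr)]
      have s2 : gradedNode n q (j + 1) ^ (β - 1) ≤ a ^ (β - 1) :=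
        Real.rpow_le_rpow_of_nonpos hapos (node_mono hq1 (by omega)) (by linarith)
      set b := gradedNode n q (j + 1) with hb
      calc _ ≤ (q * b / ((j : ℝ) + 1)) ^ 3 * a ^ (β - 1) / b ^ 3 := by
            gcongr
            linarith
        _ = _ := by field_simp
    · have hij : (j : ℝ) ≤ i := by exact_mod_cast h
      rw [min_eq_left (by gcongr)]
      have s2 : gradedNode n q (j + 1) ^ (β - 1) * gradedNode n q (j + 1) ^ 3 ≤
          a ^ (β - 1) * a ^ 3 * (((j : ℝ) + 1) / (i + 1)) ^ 3 := by
        have e : gradedNode n q (j + 1) = a * (((j : ℝ) + 1) / (i + 1)) ^ q := by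
          rw [ha]; unfold gradedNode
          rw [← Real.mul_rpow (by positivity) (by positivity)]
          congr 1
          push_cast
          field_simp
        have e2 : ∀ b : ℝ, 0 < b → b ^ (β - 1) * b ^ 3 = b ^ (β + 2) := by
          intro b hb
          rw [← Real.rpow_natCast b 3, ← Real.rpow_add hb]
          congr 1; push_cast; ring
        rw [e2 _ hbpos, e2 _ hapos, e, Real.mul_rpow hapos.le (by positivity),
          ← Real.rpow_mul (by positivity)]
        gcongr
        rw [← Real.rpow_natCast _ 3]
        apply Real.rpow_le_rpow_of_exponent_ge (by positivity)
        · rw [div_le_one hi]; linarith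
        · push_cast; nlinarith
      set b := gradedNode n q (j + 1) with hb
      calc _ ≤ (q * b / ((j : ℝ) + 1)) ^ 3 * b ^ (β - 1) / a ^ 3 := by
            gcongr
            linarith
        _ = (q / ((j : ℝ) + 1)) ^ 3 / a ^ 3 * (b ^ (β - 1) * b ^ 3) := by field_simp
        _ ≤ (q / ((j : ℝ) + 1)) ^ 3 / a ^ 3 * (a ^ (β - 1) * a ^ 3 * (((j : ℝ) + 1) / (i + 1)) ^ 3) := by
            gcongr
        _ = _ := by field_simp
  calc _ ≤ ∑ j ∈ Finset.range n,
        q ^ 3 * a ^ (β - 1) * min (((i : ℝ) + 1) ^ 3)⁻¹ (((j : ℝ) + 1) ^ 3)⁻¹ :=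
        Finset.sum_le_sum fun j _ => key j
    _ = q ^ 3 * a ^ (β - 1) * ∑ j ∈ Finset.range n, min (((i : ℝ) + 1) ^ 3)⁻¹ (((j : ℝ) + 1) ^ 3)⁻¹ := by
        rw [Finset.mul_sum]
    _ ≤ q ^ 3 * a ^ (β - 1) * (2 * (((i : ℝ) + 1) ^ 2)⁻¹) := by
        gcongr
        exact sum_min i n _ (fun j => min_le_left _ _) (fun j => min_le_right _ _)
    _ = _ := by ring

/-- The denominator. -/
noncomputable def den (c x y : ℝ) : ℝ := x ^ 2 + y ^ 2 + 2 * x * y * c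

lemma kernel_eq (p x y : ℝ) : cornerKernel p x y =
    Real.sin (p * Real.pi) / Real.pi * x / den (Real.cos (p * Real.pi)) x y := rfl

lemma den_ge {c x y : ℝ} (hc1 : c ≤ 1) : (1 + c) / 2 * (x + y) ^ 2 ≤ den c x y := by
  unfold den
  nlinarith [mul_nonneg (sub_nonneg.2 hc1) (sq_nonneg (x - y))]

lemma kdiff {s c x y z a m T : ℝ} (hc0 : -1 ≤ c) (hc1 : c ≤ 1) (hm : 0 < m) (hT : 0 < T)
    (hs : 0 ≤ s)
    (hx0 : 0 ≤ x) (hxa : x ≤ a) (haT : a ≤ T) (hy0 : 0 ≤ y) (hyz : y ≤ z) (hzT : z ≤ T)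
    (hd1 : m * T ^ 2 ≤ den c x y) (hd2 : m * T ^ 2 ≤ den c x z) :
    |s * x / den c x y - s * x / den c x z| ≤ 4 * s / m ^ 2 * (a * (z - y) / T ^ 3) := by
  have hmT : 0 < m * T ^ 2 := by positivity
  have e : s * x / den c x y - s * x / den c x z =
      s * x * (z - y) * (z + y + 2 * x * c) / (den c x y * den c x z) := by
    rw [div_sub_div _ _ (by linarith) (by linarith)]
    congr 1
    unfold den; ring
  have h1 : |z + y + 2 * x * c| ≤ 4 * T := by
    rw [abs_le]; constructor <;> nlinarith
  rw [e, abs_div, abs_mul, abs_of_nonneg (a := s * x * (z - y))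
    (mul_nonneg (by positivity) (by linarith)), abs_of_pos (a := den c x y * den c x z)
    (mul_pos (by linarith) (by linarith))]
  calc _ ≤ s * a * (z - y) * (4 * T) / (m * T ^ 2 * (m * T ^ 2)) := by
        have : 0 ≤ z - y := by linarith
        have ha0 : 0 ≤ a := hx0.trans hxa
        have hdp : 0 < den c x y := by linarith
        gcongr
    _ = _ := by field_simp

lemma kmixed {s c x x' y z m T : ℝ} (hc0 : -1 ≤ c) (hc1 : c ≤ 1) (hm : 0 < m) (hT : 0 < T)
    (hs : 0 ≤ s)
    (hx0 : 0 ≤ x) (hxT : x ≤ T) (hx0' : 0 ≤ x') (hxT' : x' ≤ T)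
    (hy0 : 0 ≤ y) (hyz : y ≤ z) (hzT : z ≤ T)
    (hd1 : m * T ^ 2 ≤ den c x y) (hd2 : m * T ^ 2 ≤ den c x z)
    (hd1' : m * T ^ 2 ≤ den c x' y) (hd2' : m * T ^ 2 ≤ den c x' z) :
    |(s * x / den c x y - s * x' / den c x' y) - (s * x / den c x z - s * x' / den c x' z)| ≤
      s * (6 / m ^ 2 + 32 / m ^ 3) * (|x - x'| * (z - y) / T ^ 3) := by
  have hmT : 0 < m * T ^ 2 := by positivity
  have pA : 0 < den c x y := by linarith
  have pB : 0 < den c x z := by linarith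
  have pA' : 0 < den c x' y := by linarith
  have pB' : 0 < den c x' z := by linarith
  set P := x * (z + y + 2 * x * c) with hP
  set P' := x' * (z + y + 2 * x' * c) with hP'
  have e : (s * x / den c x y - s * x' / den c x' y) - (s * x / den c x z - s * x' / den c x' z) =
      s * (z - y) * ((P - P') / (den c x y * den c x z)
        + P' * (den c x' y - den c x y) / (den c x y * den c x' y * den c x z)
        + P' * (den c x' z - den c x z) / (den c x' y * den c x z * den c x' z)) := by
    have e1 : ∀ x, 0 < den c x y → 0 < den c x z → s * x / den c x y - s * x / den c x z =
        s * (z - y) * (x * (z + y + 2 * x * c) / (den c x y * den c x z)) := by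
      intro x h1 h2
      rw [div_sub_div _ _ h1.ne' h2.ne', ← mul_div_assoc]
      congr 1
      unfold den; ring
    have e2 : (P - P') / (den c x y * den c x z)
        + P' * (den c x' y - den c x y) / (den c x y * den c x' y * den c x z)
        + P' * (den c x' z - den c x z) / (den c x' y * den c x z * den c x' z) =
        P / (den c x y * den c x z) - P' / (den c x' y * den c x' z) := by
      field_simp
      ring
    rw [e2, mul_sub, ← e1 x pA pB, ← e1 x' pA' pB']
    ring
  have hd : 0 ≤ |x - x'| := abs_nonneg _
  have bP' : |P'| ≤ 4 * T ^ 2 := by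
    rw [hP', abs_mul, abs_of_nonneg hx0']
    have : |z + y + 2 * x' * c| ≤ 4 * T := by
      rw [abs_le]; constructor <;> nlinarith
    calc _ ≤ T * (4 * T) := by gcongr
      _ = _ := by ring
  have bPP : |P - P'| ≤ |x - x'| * (6 * T) := by
    have : P - P' = (x - x') * (z + y + 2 * (x + x') * c) := by rw [hP, hP']; ring
    rw [this, abs_mul]
    gcongr
    rw [abs_le]; constructor <;> nlinarith
  have bD : ∀ y, 0 ≤ y → y ≤ T → |den c x' y - den c x y| ≤ |x - x'| * (4 * T) := by
    intro y h1 h2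
    have : den c x' y - den c x y = -((x - x') * (x + x' + 2 * y * c)) := by unfold den; ring
    rw [this, abs_neg, abs_mul]
    gcongr
    rw [abs_le]; constructor <;> nlinarith
  have bA := bD y hy0 (by linarith)
  have bB := bD z (by linarith) hzT
  have hzy : 0 ≤ z - y := by linarith
  have t1 : |(P - P') / (den c x y * den c x z)| ≤ |x - x'| * (6 * T) / (m * T ^ 2 * (m * T ^ 2)) := by
    rw [abs_div, abs_of_pos (mul_pos pA pB)]
    gcongr
  have t2 : |P' * (den c x' y - den c x y) / (den c x y * den c x' y * den c x z)| ≤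
      4 * T ^ 2 * (|x - x'| * (4 * T)) / (m * T ^ 2 * (m * T ^ 2) * (m * T ^ 2)) := by
    rw [abs_div, abs_mul, abs_of_pos (mul_pos (mul_pos pA pA') pB)]
    gcongr
  have t3 : |P' * (den c x' z - den c x z) / (den c x' y * den c x z * den c x' z)| ≤
      4 * T ^ 2 * (|x - x'| * (4 * T)) / (m * T ^ 2 * (m * T ^ 2) * (m * T ^ 2)) := by
    rw [abs_div, abs_mul, abs_of_pos (mul_pos (mul_pos pA' pB) pB')]
    gcongr
  rw [e, abs_mul, abs_of_nonneg (mul_nonneg hs hzy)]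
  calc _ ≤ s * (z - y) * (|x - x'| * (6 * T) / (m * T ^ 2 * (m * T ^ 2))
        + 4 * T ^ 2 * (|x - x'| * (4 * T)) / (m * T ^ 2 * (m * T ^ 2) * (m * T ^ 2))
        + 4 * T ^ 2 * (|x - x'| * (4 * T)) / (m * T ^ 2 * (m * T ^ 2) * (m * T ^ 2))) := by
        gcongr
        exact (abs_add_three _ _ _).trans (by gcongr)
    _ = _ := by field_simp; ring

lemma ksep {n : ℕ} {q c : ℝ} (hn : 1 ≤ n) (hq : 1 ≤ q) (hc0 : -1 < c) (hc1 : c ≤ 1)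
    {i j : ℕ} (hij : i ≠ 0 ∨ j ≠ 0) {x y : ℝ} (hx : x ∈ cell n q i) (hy : y ∈ cell n q j) :
    (1 + c) / 2 * (1 / (2 * 2 ^ q)) ^ 2 * (gradedNode n q (i + 1) + gradedNode n q (j + 1)) ^ 2
      ≤ den c x y := by
  have h2 : (1 : ℝ) ≤ 2 ^ q := Real.one_le_rpow (by norm_num) (by linarith)
  have lower : ∀ i : ℕ, i ≠ 0 → ∀ x ∈ cell n q i, gradedNode n q (i + 1) ≤ 2 ^ q * x := by
    intro i hi x hx
    obtain ⟨k, rfl⟩ := Nat.exists_eq_succ_of_ne_zero hi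
    refine (node_dbl hn hq k).trans ?_
    have := hx.1.le
    gcongr
  have hx0 : 0 ≤ x := (node_nonneg i).trans hx.1.le
  have hy0 : 0 ≤ y := (node_nonneg j).trans hy.1.le
  have a0 : 0 ≤ gradedNode n q (i + 1) := node_nonneg _
  have b0 : 0 ≤ gradedNode n q (j + 1) := node_nonneg _
  have main : gradedNode n q (i + 1) + gradedNode n q (j + 1) ≤ 2 * 2 ^ q * (x + y) := by
    by_cases hi : i = 0
    · have hj : j ≠ 0 := by tauto
      have l := lower j hj y hy
      have : gradedNode n q (i + 1) ≤ gradedNode n q (j + 1) := node_mono hq (by omega)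
      nlinarith
    · have l := lower i hi x hx
      by_cases hj : j = 0
      · have : gradedNode n q (j + 1) ≤ gradedNode n q (i + 1) := node_mono hq (by omega)
        nlinarith
      · have l' := lower j hj y hy
        nlinarith
  refine le_trans ?_ (den_ge hc1)
  rw [mul_assoc, ← mul_pow]
  have : 0 < 1 + c := by linarith
  gcongr
  rw [one_div, inv_mul_le_iff₀ (by positivity)]
  exact main

lemma den_pos {c x y : ℝ} (hc0 : -1 < c) (hc1 : c ≤ 1) (hx : 0 < x) (hy : 0 ≤ y) :
    0 < den c x y := by
  refine lt_of_lt_of_le ?_ (den_ge hc1)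
  have : 0 < 1 + c := by linarith
  positivity

lemma kcont {s c x : ℝ} (hc0 : -1 < c) (hc1 : c ≤ 1) (hx : 0 < x) :
    ContinuousOn (fun y => s * x / den c x y) (Set.Icc 0 1) := by
  apply ContinuousOn.div continuousOn_const
  · unfold den; fun_prop
  · intro y hy
    exact (den_pos hc0 hc1 hx hy.1).ne'

lemma kint {x a : ℝ} (hx : 0 < x) (ha : 0 ≤ a) :
    IntegrableOn (fun y => x / (x + y) ^ 2) (Set.Ioc 0 a) ∧
    ∫ y in Set.Ioc 0 a, x / (x + y) ^ 2 ≤ 1 := by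
  have hc : ContinuousOn (fun y => x / (x + y) ^ 2) (Set.Icc 0 a) := by
    apply ContinuousOn.div continuousOn_const (by fun_prop)
    intro y hy
    have := hy.1
    positivity
  have hi : IntervalIntegrable (fun y => x / (x + y) ^ 2) volume 0 a :=
    ContinuousOn.intervalIntegrable (by rwa [Set.uIcc_of_le ha])
  refine ⟨(intervalIntegrable_iff_integrableOn_Ioc_of_le ha).1 hi, ?_⟩
  rw [← intervalIntegral.integral_of_le ha]
  rw [intervalIntegral.integral_eq_sub_of_hasDerivAt (f := fun y => - (x / (x + y))) _ hi]
  · have h1 : 0 ≤ x / (x + a) := by positivity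
    have h2 : x / (x + 0) = 1 := by rw [add_zero, div_self hx.ne']
    linarith
  · intro y hy
    rw [Set.uIcc_of_le ha] at hy
    have hne : x + y ≠ 0 := by linarith [hy.1]
    have h := (((hasDerivAt_id y).const_add x).inv hne).const_mul (-x)
    have ef : (fun y => -(x / (x + y))) = fun y => -x * (fun x_1 => x + id x_1)⁻¹ y := by
      funext z
      simp [div_eq_mul_inv]
    have ev : x / (x + y) ^ 2 = -x * (-1 / (x + id y) ^ 2) := by
      simp only [id]; ring
    rw [ef, ev]
    exact h

lemma cell0_bound {n : ℕ} {q β M s c x : ℝ} (hn : 1 ≤ n) (hq : 1 ≤ q) {w : ℝ → ℝ} (hM : 0 ≤ M)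
    (hs : 0 ≤ s) (hc0 : -1 < c) (hc1 : c ≤ 1) (hx : 0 < x)
    (hw : IntegrableOn w (Set.Ioc 0 1)) (hH : Hosc n q β M w) :
    |∫ y in cell n q 0, s * x / den c x y * (w y - gradedProj n q w y)| ≤
      s / ((1 + c) / 2) *
      (M * (gradedNode n q (0 + 1) - gradedNode n q 0) * gradedNode n q (0 + 1) ^ (β - 1)) := by
  have hms : MeasurableSet (cell n q 0) := measurableSet_Ioc
  set E := M * (gradedNode n q (0 + 1) - gradedNode n q 0) * gradedNode n q (0 + 1) ^ (β - 1) with hE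
  have hE0 : 0 ≤ E := by
    have := node_strict hn hq 0 (n := n)
    have := node_pos (q := q) hn 0
    exact mul_nonneg (mul_nonneg hM (by linarith)) (by positivity)
  have hδ : 0 < (1 + c) / 2 := by linarith
  have hcell : cell n q 0 = Set.Ioc 0 (gradedNode n q (0 + 1)) := by
    unfold cell; rw [node_zero hq]
  obtain ⟨k1, k2⟩ := kint hx (node_nonneg (n := n) (q := q) (0 + 1))
  rw [← hcell] at k1 k2
  have := norm_integral_le_of_norm_le (μ := volume.restrict (cell n q 0))
    (f := fun y => s * x / den c x y * (w y - gradedProj n q w y))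
    (g := fun y => s / ((1 + c) / 2) * E * (x / (x + y) ^ 2)) (k1.const_mul _) (by
      filter_upwards [ae_restrict_mem hms] with y hy
      have hy0 : 0 ≤ y := (node_nonneg 0).trans hy.1.le
      have hp := den_pos hc0 hc1 hx hy0
      have hb := err_bound hn hq hw hH (by omega) hy
      rw [norm_mul, Real.norm_of_nonneg (by positivity)]
      calc _ ≤ s * x / ((1 + c) / 2 * (x + y) ^ 2) * E := by
            refine mul_le_mul ?_ hb (norm_nonneg _) (by positivity)
            have := den_ge (x := x) (y := y) hc1
            gcongr
        _ = _ := by field_simp)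
  rw [integral_const_mul] at this
  refine this.trans ?_
  calc _ ≤ s / ((1 + c) / 2) * E * 1 := by gcongr
    _ = _ := by ring

lemma err_eq_sum {n : ℕ} {q : ℝ} (hn : 1 ≤ n) (hq : 1 ≤ q) {w g : ℝ → ℝ}
    (hw : IntegrableOn w (Set.Ioc 0 1)) (hg : ContinuousOn g (Set.Icc 0 1)) :
    IntegrableOn (fun y => g y * (w y - gradedProj n q w y)) (Set.Ioc 0 1) ∧
    ∫ y in Set.Ioc (0 : ℝ) 1, g y * (w y - gradedProj n q w y) =
      ∑ j ∈ Finset.range n, ∫ y in cell n q j, g y * (w y - gradedProj n q w y) := by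
  have hI : IntegrableOn (fun y => g y * (w y - gradedProj n q w y)) (Set.Ioc 0 1) := by
    obtain ⟨A, hA⟩ := isCompact_Icc.exists_bound_of_continuousOn hg
    refine Integrable.bdd_mul (c := A) (err_int hn hq hw) ?_ ?_
    · exact (hg.mono Set.Ioc_subset_Icc_self).aestronglyMeasurable measurableSet_Ioc
    · filter_upwards [ae_restrict_mem measurableSet_Ioc] with y hy
      exact hA y (Set.Ioc_subset_Icc_self hy)
  exact ⟨hI, cell_sum hn hq hI⟩

lemma key_bound (p q : ℝ) (hp0 : 0 < p) (hp1 : p < 1) (hq : 4 ≤ q) :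
    ∃ C : ℝ, 0 < C ∧ ∀ n : ℕ, 1 ≤ n → ∀ β M : ℝ, 2 / q ≤ β → β ≤ 1 → 0 ≤ M → ∀ w : ℝ → ℝ,
      IntegrableOn w (Set.Ioc 0 1) → Hosc n q β M w →
      Hosc n q (β - 2 / q) (C * M * ((n : ℝ) ^ 2)⁻¹) (cornerErr p q n w) ∧
      ∀ x ∈ Set.Ioc (0 : ℝ) 1, |cornerErr p q n w x| ≤ C * M * ((n : ℝ) ^ 2)⁻¹ := by
  have hq1 : 1 ≤ q := by linarith
  have hpp : 0 < p * Real.pi := by positivity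
  have hpp1 : p * Real.pi < Real.pi := by nlinarith [Real.pi_pos]
  set s := Real.sin (p * Real.pi) / Real.pi with hs
  set c := Real.cos (p * Real.pi) with hc
  have hspos : 0 < s := div_pos (Real.sin_pos_of_pos_of_lt_pi hpp hpp1) Real.pi_pos
  have hc1 : c ≤ 1 := Real.cos_le_one _
  have hc0 : -1 < c := by
    rw [← Real.cos_pi]
    exact Real.cos_lt_cos_of_nonneg_of_le_pi hpp.le le_rfl hpp1
  have hδ : 0 < (1 + c) / 2 := by linarith
  set m := (1 + c) / 2 * (1 / (2 * 2 ^ q)) ^ 2 with hm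
  have hmpos : 0 < m := by positivity
  set C1 := 4 * s / m ^ 2 + 8 * (s / ((1 + c) / 2)) with hC1
  have hC1pos : 0 < C1 := by positivity
  set C2 := s * (6 / m ^ 2 + 32 / m ^ 3) with hC2
  have hC2pos : 0 < C2 := by positivity
  refine ⟨2 * q ^ 3 * (2 * C1 + C2), by positivity, ?_⟩
  intro n hn β M hβ0 hβ1 hM w hw hH
  have hβ0' : 0 ≤ β := le_trans (by positivity) hβ0
  have hnp : (0 : ℝ) < n := by positivity
  have hv : ∀ x, cornerErr p q n w x =
      ∫ y in Set.Ioc (0 : ℝ) 1, s * x / den c x y * (w y - gradedProj n q w y) := fun x => rfl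
  -- value bound
  have val : ∀ i < n, ∀ x ∈ cell n q i, |cornerErr p q n w x| ≤
      C1 * M * (2 * q ^ 3) * (((n : ℝ) ^ 2)⁻¹ * gradedNode n q (i + 1) ^ (β - 2 / q)) := by
    intro i hi x hx
    have hx0 : 0 < x := (node_nonneg i).trans_lt hx.1
    have ha : 0 < gradedNode n q (i + 1) := node_pos hn i
    have hcont := kcont (s := s) hc0 hc1 hx0
    rw [hv, (err_eq_sum hn hq1 hw hcont).2]
    have hterm : ∀ j ∈ Finset.range n,
        |∫ y in cell n q j, s * x / den c x y * (w y - gradedProj n q w y)| ≤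
        C1 * M * gradedNode n q (i + 1) * ((gradedNode n q (j + 1) - gradedNode n q j) ^ 3 *
          gradedNode n q (j + 1) ^ (β - 1) /
          (gradedNode n q (i + 1) + gradedNode n q (j + 1)) ^ 3) := by
      intro j hj
      have hj := Finset.mem_range.1 hj
      have hb : 0 < gradedNode n q (j + 1) := node_pos hn j
      have hh : 0 < gradedNode n q (j + 1) - gradedNode n q j := by
        linarith [node_strict hn hq1 j (n := n)]
      by_cases hij : i ≠ 0 ∨ j ≠ 0
      · have hz : gradedNode n q (j + 1) ∈ cell n q j := ⟨by linarith, le_rfl⟩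
        refine (cell_bound (B := 4 * s / m ^ 2 * (gradedNode n q (i + 1) *
          (gradedNode n q (j + 1) - gradedNode n q j) /
          (gradedNode n q (i + 1) + gradedNode n q (j + 1)) ^ 3)) hn hq1 hw hH hj hcont ?_).trans ?_
        · intro y hy
          have hy0 : 0 ≤ y := (node_nonneg j).trans hy.1.le
          refine (kdiff hc0.le hc1 hmpos (add_pos ha hb) hspos.le hx0.le hx.2 (by linarith) hy0 hy.2
            (by linarith) (ksep hn hq1 hc0 hc1 hij hx hy) (ksep hn hq1 hc0 hc1 hij hx hz)).trans ?_
          have := hy.1.le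
          gcongr
        · calc _ = 4 * s / m ^ 2 * M * gradedNode n q (i + 1) *
                ((gradedNode n q (j + 1) - gradedNode n q j) ^ 3 *
                gradedNode n q (j + 1) ^ (β - 1) /
                (gradedNode n q (i + 1) + gradedNode n q (j + 1)) ^ 3) := by ring
            _ ≤ _ := by
                gcongr
                rw [hC1]
                have : 0 < 8 * (s / ((1 + c) / 2)) := by positivity
                linarith
      · have hi0 : i = 0 := by tauto
        have hj0 : j = 0 := by tauto
        subst hi0 hj0
        refine (cell0_bound hn hq1 hM hspos.le hc0 hc1 hx0 hw hH).trans ?_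
        rw [node_zero hq1, sub_zero]
        calc _ = 8 * (s / ((1 + c) / 2)) * M * gradedNode n q (0 + 1) *
                (gradedNode n q (0 + 1) ^ 3 * gradedNode n q (0 + 1) ^ (β - 1) /
                (gradedNode n q (0 + 1) + gradedNode n q (0 + 1)) ^ 3) := by
                field_simp
                ring
            _ ≤ _ := by
                gcongr
                rw [hC1]
                have : 0 < 4 * s / m ^ 2 := by positivity
                linarith
    calc _ ≤ _ := Finset.abs_sum_le_sum_abs _ _
      _ ≤ _ := Finset.sum_le_sum hterm
      _ = C1 * M * gradedNode n q (i + 1) * ∑ j ∈ Finset.range n, _ := by rw [Finset.mul_sum]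
      _ ≤ C1 * M * gradedNode n q (i + 1) *
          (2 * q ^ 3 * (((n : ℝ) ^ 2)⁻¹ * gradedNode n q (i + 1) ^ (β - 1 - 2 / q))) := by
          refine mul_le_mul_of_nonneg_left (mesh_sum hn hq hβ0' hβ1 i) (by positivity)
      _ = _ := by
          have : gradedNode n q (i + 1) ^ (β - 2 / q) =
              gradedNode n q (i + 1) * gradedNode n q (i + 1) ^ (β - 1 - 2 / q) := by
            rw [mul_comm, ← Real.rpow_add_one ha.ne']
            congr 1; ring
          rw [this]; ring
  constructor
  · intro i hi x hx x' hx'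
    have ha : 0 < gradedNode n q (i + 1) := node_pos hn i
    by_cases hi0 : i = 0
    · subst hi0
      have h1 := val 0 hi x hx
      have h2 := val 0 hi x' hx'
      rw [node_zero hq1, sub_zero]
      have : gradedNode n q (0 + 1) ^ (β - 2 / q) =
              gradedNode n q (0 + 1) * gradedNode n q (0 + 1) ^ (β - 2 / q - 1) := by
            rw [mul_comm, ← Real.rpow_add_one ha.ne']
            congr 1; ring
      rw [mul_assoc _ (gradedNode n q (0 + 1)), ← this]
      calc _ ≤ |cornerErr p q n w x| + |cornerErr p q n w x'| := abs_sub _ _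
        _ ≤ 2 * q ^ 3 * (2 * C1 + 0) * M * ((n : ℝ) ^ 2)⁻¹ * gradedNode n q (0 + 1) ^ (β - 2 / q) := by
          linarith
        _ ≤ _ := by gcongr
    · have hx0 : 0 < x := (node_nonneg i).trans_lt hx.1
      have hx0' : 0 < x' := (node_nonneg i).trans_lt hx'.1
      have hcont := kcont (s := s) hc0 hc1 hx0
      have hcont' := kcont (s := s) hc0 hc1 hx0'
      have hxx : |x - x'| ≤ gradedNode n q (i + 1) - gradedNode n q i := by
        rw [abs_le]; constructor <;> linarith [hx.1, hx.2, hx'.1, hx'.2]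
      have hcd : ContinuousOn (fun y => s * x / den c x y - s * x' / den c x' y) (Set.Icc 0 1) :=
        hcont.sub hcont'
      have ediff : cornerErr p q n w x - cornerErr p q n w x' =
          ∑ j ∈ Finset.range n, ∫ y in cell n q j,
            (s * x / den c x y - s * x' / den c x' y) * (w y - gradedProj n q w y) := by
        rw [← (err_eq_sum hn hq1 hw hcd).2, hv, hv, ← integral_sub (err_eq_sum hn hq1 hw hcont).1
          (err_eq_sum hn hq1 hw hcont').1]
        refine integral_congr_ae (Filter.Eventually.of_forall fun y => ?_)
        simp only
        ring
      rw [ediff]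
      have hhi : 0 < gradedNode n q (i + 1) - gradedNode n q i := by
        linarith [node_strict hn hq1 i (n := n)]
      have hterm : ∀ j ∈ Finset.range n,
          |∫ y in cell n q j, (s * x / den c x y - s * x' / den c x' y) *
            (w y - gradedProj n q w y)| ≤
          C2 * M * (gradedNode n q (i + 1) - gradedNode n q i) *
            ((gradedNode n q (j + 1) - gradedNode n q j) ^ 3 *
            gradedNode n q (j + 1) ^ (β - 1) /
            (gradedNode n q (i + 1) + gradedNode n q (j + 1)) ^ 3) := by
        intro j hj
        have hj := Finset.mem_range.1 hj
        have hb : 0 < gradedNode n q (j + 1) := node_pos hn j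
        have hh : 0 < gradedNode n q (j + 1) - gradedNode n q j := by
          linarith [node_strict hn hq1 j (n := n)]
        have hz : gradedNode n q (j + 1) ∈ cell n q j := ⟨by linarith, le_rfl⟩
        have hij : i ≠ 0 ∨ j ≠ 0 := Or.inl hi0
        refine (cell_bound (B := C2 * ((gradedNode n q (i + 1) - gradedNode n q i) *
          (gradedNode n q (j + 1) - gradedNode n q j) /
          (gradedNode n q (i + 1) + gradedNode n q (j + 1)) ^ 3)) hn hq1 hw hH hj hcd ?_).trans ?_
        · intro y hy
          have hy0 : 0 ≤ y := (node_nonneg j).trans hy.1.le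
          refine (kmixed hc0.le hc1 hmpos (add_pos ha hb) hspos.le hx0.le (by linarith [hx.2])
            hx0'.le (by linarith [hx'.2]) hy0 hy.2
            (by linarith) (ksep hn hq1 hc0 hc1 hij hx hy) (ksep hn hq1 hc0 hc1 hij hx hz)
            (ksep hn hq1 hc0 hc1 hij hx' hy) (ksep hn hq1 hc0 hc1 hij hx' hz)).trans ?_
          have := hy.1.le
          have hzy : 0 ≤ gradedNode n q (j + 1) - y := by linarith [hy.2]
          gcongr
        · exact le_of_eq (by ring)
      calc _ ≤ _ := Finset.abs_sum_le_sum_abs _ _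
        _ ≤ _ := Finset.sum_le_sum hterm
        _ = C2 * M * (gradedNode n q (i + 1) - gradedNode n q i) * ∑ j ∈ Finset.range n, _ := by
            rw [Finset.mul_sum]
        _ ≤ C2 * M * (gradedNode n q (i + 1) - gradedNode n q i) *
            (2 * q ^ 3 * (((n : ℝ) ^ 2)⁻¹ * gradedNode n q (i + 1) ^ (β - 1 - 2 / q))) := by
            refine mul_le_mul_of_nonneg_left (mesh_sum hn hq hβ0' hβ1 i) (by positivity)
        _ = 2 * q ^ 3 * (0 + C2) * M * ((n : ℝ) ^ 2)⁻¹ *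
            (gradedNode n q (i + 1) - gradedNode n q i) *
            gradedNode n q (i + 1) ^ (β - 2 / q - 1) := by
            rw [show β - 1 - 2 / q = β - 2 / q - 1 by ring]; ring
        _ ≤ _ := by
            gcongr
            positivity
  · intro x hx
    obtain ⟨i, hi, hxi⟩ := cell_cover hn hq1 hx
    have h1 := val i hi x hxi
    have h2 : gradedNode n q (i + 1) ^ (β - 2 / q) ≤ 1 :=
      Real.rpow_le_one (node_nonneg _) (node_le_one hn hq1 hi) (by linarith)
    calc _ ≤ C1 * M * (2 * q ^ 3) * (((n : ℝ) ^ 2)⁻¹ * 1) := h1.trans (by gcongr)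
      _ = 2 * q ^ 3 * C1 * M * ((n : ℝ) ^ 2)⁻¹ := by ring
      _ ≤ _ := by
        gcongr
        linarith

lemma err_meas {p q : ℝ} {n : ℕ} (hn : 1 ≤ n) (hq : 1 ≤ q) {w : ℝ → ℝ}
    (hw : IntegrableOn w (Set.Ioc 0 1)) :
    AEStronglyMeasurable (cornerErr p q n w) (volume.restrict (Set.Ioc 0 1)) := by
  have he := (err_int hn hq hw).aestronglyMeasurable
  have hk : Measurable (fun z : ℝ × ℝ => cornerKernel p z.1 z.2) := by
    unfold cornerKernel
    fun_prop
  have h2 : AEStronglyMeasurable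
      (fun z : ℝ × ℝ => cornerKernel p z.1 z.2 * (w z.2 - gradedProj n q w z.2))
      ((volume.restrict (Set.Ioc (0 : ℝ) 1)).prod (volume.restrict (Set.Ioc (0 : ℝ) 1))) :=
    hk.aestronglyMeasurable.mul he.comp_snd
  exact h2.integral_prod_right'

lemma base_osc {α q : ℝ} (hα0 : 0 < α) (hα1 : α < 1) (hq : 1 ≤ q) {n : ℕ} (hn : 1 ≤ n)
    {u : ℝ → ℝ} (hu : ContDiffOn ℝ 4 u (Set.Ioc 0 1)) (hb : BddAbove (weightedSet 4 α u)) :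
    0 ≤ weightedNorm 4 α u ∧ IntegrableOn u (Set.Ioc 0 1) ∧
    Hosc n q α ((1 / α + 2 ^ q) * weightedNorm 4 α u) u := by
  set N := weightedNorm 4 α u with hN
  have h0 : ∀ t ∈ Set.Ioc (0 : ℝ) 1, |u t| ≤ N := by
    intro t ht
    refine le_csSup hb ⟨0, by norm_num, t, ht, ?_⟩
    simp [hα0.le]
  have h1 : ∀ t ∈ Set.Ioc (0 : ℝ) 1, |derivWithin u (Set.Ioc 0 1) t| ≤ N * t ^ (α - 1) := by
    intro t ht
    have h : t ^ (1 - α) * |derivWithin u (Set.Ioc 0 1) t| ≤ N := by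
      refine le_csSup hb ⟨1, by norm_num, t, ht, ?_⟩
      rw [iteratedDerivWithin_one]
      rw [max_eq_left (by push_cast; linarith)]
      simp
    rw [show α - 1 = -(1 - α) by ring, Real.rpow_neg ht.1.le, ← div_eq_mul_inv,
      le_div_iff₀ (Real.rpow_pos_of_pos ht.1 _), mul_comm]
    exact h
  have hN0 : 0 ≤ N := (abs_nonneg _).trans (h0 1 (by simp))
  have hcu := hu.continuousOn
  have hint : interior (Set.Ioc (0 : ℝ) 1) = Set.Ioo 0 1 := interior_Ioc
  have hder : ∀ t ∈ Set.Ioo (0 : ℝ) 1, HasDerivAt u (derivWithin u (Set.Ioc 0 1) t) t := by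
    intro t ht
    have hmem : Set.Ioc (0 : ℝ) 1 ∈ nhds t :=
      Filter.mem_of_superset (Ioo_mem_nhds ht.1 ht.2) Set.Ioo_subset_Ioc_self
    exact ((hu.differentiableOn (by norm_num)) t (Set.Ioo_subset_Ioc_self ht)).hasDerivWithinAt.hasDerivAt hmem
  have hderp : ∀ t ∈ Set.Ioo (0 : ℝ) 1,
      HasDerivAt (fun t => N / α * t ^ α) (N * t ^ (α - 1)) t := by
    intro t ht
    have := (Real.hasDerivAt_rpow_const (x := t) (p := α) (Or.inl ht.1.ne')).const_mul (N / α)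
    rw [← mul_assoc, div_mul_cancel₀ _ hα0.ne'] at this
    exact this
  have hcp : ContinuousOn (fun t : ℝ => N / α * t ^ α) (Set.Ioc 0 1) := by
    apply Continuous.continuousOn
    exact continuous_const.mul (Real.continuous_rpow_const hα0.le)
  have mono1 : MonotoneOn (fun t => N / α * t ^ α - u t) (Set.Ioc 0 1) := by
    apply monotoneOn_of_deriv_nonneg (convex_Ioc 0 1) (hcp.sub hcu)
    · rw [hint]; intro t ht
      exact ((hderp t ht).sub (hder t ht)).differentiableAt.differentiableWithinAt
    · rw [hint]; intro t ht
      have e : deriv ((fun t => N / α * t ^ α) - u) t = _ := ((hderp t ht).sub (hder t ht)).deriv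
      rw [e]
      linarith [le_abs_self (derivWithin u (Set.Ioc 0 1) t), h1 t (Set.Ioo_subset_Ioc_self ht)]
  have mono2 : MonotoneOn (fun t => N / α * t ^ α + u t) (Set.Ioc 0 1) := by
    apply monotoneOn_of_deriv_nonneg (convex_Ioc 0 1) (hcp.add hcu)
    · rw [hint]; intro t ht
      exact ((hderp t ht).add (hder t ht)).differentiableAt.differentiableWithinAt
    · rw [hint]; intro t ht
      have e : deriv ((fun t => N / α * t ^ α) + u) t = _ := ((hderp t ht).add (hder t ht)).deriv
      rw [e]
      linarith [neg_abs_le (derivWithin u (Set.Ioc 0 1) t), h1 t (Set.Ioo_subset_Ioc_self ht)]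
  have hdiff : ∀ z ∈ Set.Ioc (0 : ℝ) 1, ∀ y ∈ Set.Ioc (0 : ℝ) 1, z ≤ y →
      |u y - u z| ≤ N / α * (y ^ α - z ^ α) := by
    intro z hz y hy hzy
    have a1 := mono1 hz hy hzy
    have a2 := mono2 hz hy hzy
    simp only at a1 a2
    rw [abs_le]; constructor <;> linarith
  refine ⟨hN0, ?_, ?_⟩
  · refine Integrable.of_bound (hcu.aestronglyMeasurable measurableSet_Ioc) N ?_
    filter_upwards [ae_restrict_mem measurableSet_Ioc] with y hy
    exact h0 y hy
  · intro j hj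
    have hcs := cell_sub hn hq hj
    have hb0 : 0 < gradedNode n q (j + 1) := node_pos hn j
    have hh : 0 < gradedNode n q (j + 1) - gradedNode n q j := by
      linarith [node_strict hn hq j (n := n)]
    have h2q : (1 : ℝ) ≤ 2 ^ q := Real.one_le_rpow (by norm_num) (by linarith)
    have main : ∀ z ∈ cell n q j, ∀ y ∈ cell n q j, z ≤ y → |u y - u z| ≤
        (1 / α + 2 ^ q) * N * (gradedNode n q (j + 1) - gradedNode n q j) *
          gradedNode n q (j + 1) ^ (α - 1) := by
      intro z hz y hy hzy
      have hz0 := (hcs hz).1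
      have hy0 := (hcs hy).1
      refine (hdiff z (hcs hz) y (hcs hy) hzy).trans ?_
      by_cases hj0 : j = 0
      · subst hj0
        rw [node_zero hq, sub_zero]
        have e : gradedNode n q (0 + 1) * gradedNode n q (0 + 1) ^ (α - 1) =
            gradedNode n q (0 + 1) ^ α := by
          rw [mul_comm, ← Real.rpow_add_one hb0.ne']; congr 1; ring
        rw [mul_assoc _ (gradedNode n q (0 + 1)), e]
        calc N / α * (y ^ α - z ^ α) ≤ N / α * gradedNode n q (0 + 1) ^ α := by
              have : y ^ α ≤ gradedNode n q (0 + 1) ^ α := Real.rpow_le_rpow hy0.le hy.2 hα0.le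
              have : 0 < z ^ α := Real.rpow_pos_of_pos hz0 _
              gcongr
              linarith
          _ = (1 / α + 0) * N * gradedNode n q (0 + 1) ^ α := by ring
          _ ≤ _ := by
              gcongr
              positivity
      · obtain ⟨k, rfl⟩ := Nat.exists_eq_succ_of_ne_zero hj0
        have hdbl : gradedNode n q (k + 1 + 1) ≤ 2 ^ q * z :=
          (node_dbl hn hq k).trans (by have := hz.1.le; gcongr)
        have c1 : y ^ α - z ^ α ≤ α * z ^ (α - 1) * (y - z) := by
          have hyz : y = z * (1 + (y - z) / z) := by field_simp; ring
          have hr : 0 ≤ (y - z) / z := div_nonneg (by linarith) hz0.le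
          have := rpow_one_add_le_one_add_mul_self (s := (y - z) / z) (p := α) (by linarith)
            hα0.le hα1.le
          have e2 : y ^ α = z ^ α * (1 + (y - z) / z) ^ α := by
            rw [← Real.mul_rpow hz0.le (by linarith), ← hyz]
          have e3 : z ^ (α - 1) = z ^ α / z := Real.rpow_sub_one hz0.ne' _
          rw [e2, e3]
          have hzα : 0 < z ^ α := Real.rpow_pos_of_pos hz0 _
          calc _ ≤ z ^ α * (1 + α * ((y - z) / z)) - z ^ α := by gcongr
            _ = _ := by ring
        have c2 : z ^ (α - 1) ≤ 2 ^ q * gradedNode n q (k + 1 + 1) ^ (α - 1) := by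
          have d1 : (2 ^ q * z) ^ (α - 1) ≤ gradedNode n q (k + 1 + 1) ^ (α - 1) :=
            Real.rpow_le_rpow_of_nonpos hb0 hdbl (by linarith)
          rw [Real.mul_rpow (by positivity) hz0.le] at d1
          have d2 : (1 : ℝ) ≤ 2 ^ q * (2 ^ q) ^ (α - 1) := by
            rw [mul_comm, ← Real.rpow_add_one (by positivity)]
            exact Real.one_le_rpow h2q (by linarith)
          have hz1 : 0 < z ^ (α - 1) := Real.rpow_pos_of_pos hz0 _
          calc z ^ (α - 1) = 1 * z ^ (α - 1) := by ring
            _ ≤ 2 ^ q * (2 ^ q) ^ (α - 1) * z ^ (α - 1) := by gcongr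
            _ = 2 ^ q * ((2 ^ q) ^ (α - 1) * z ^ (α - 1)) := by ring
            _ ≤ _ := by gcongr
        have hyz : y - z ≤ gradedNode n q (k + 1 + 1) - gradedNode n q (k + 1) := by
          linarith [hy.2, hz.1]
        have hyz0 : 0 ≤ y - z := by linarith
        calc N / α * (y ^ α - z ^ α) ≤ N / α * (α * (2 ^ q * gradedNode n q (k + 1 + 1) ^ (α - 1)) *
              (gradedNode n q (k + 1 + 1) - gradedNode n q (k + 1))) := by
              gcongr
              refine c1.trans ?_
              gcongr
          _ = (0 + 2 ^ q) * N * (gradedNode n q (k + 1 + 1) - gradedNode n q (k + 1)) *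
            gradedNode n q (k + 1 + 1) ^ (α - 1) := by field_simp; ring
          _ ≤ _ := by
              gcongr
              positivity
    intro y hy z hz
    rcases le_total z y with h | h
    · exact main z hz y hy h
    · rw [abs_sub_comm]; exact main y hy z hz h

/-- For `p ∈ (0,1)`, `0 < α < 1/(1+p)` and grading exponent `q > 4/α`, there is a
constant `C > 0`, independent of `n` and `u`, such that for every `u ∈ C⁴_α`,
`sup_{x∈(0,1]} |(K(I − π_h)K(I − π_h)u)(x)| ≤ C·n⁻⁴·‖u‖_{4,α}`. -/
theorem cornerErr_squared_uniform_bound (p α q : ℝ)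
    (hp0 : 0 < p) (hp1 : p < 1) (hα0 : 0 < α) (hα1 : α < 1 / (1 + p))
    (hq : q > 4 / α) :
    ∃ C : ℝ, 0 < C ∧ ∀ n : ℕ, 1 ≤ n → ∀ u : ℝ → ℝ,
      ContDiffOn ℝ 4 u (Set.Ioc 0 1) → BddAbove (weightedSet 4 α u) →
      ∀ x ∈ Set.Ioc (0 : ℝ) 1,
        |cornerErr p q n (cornerErr p q n u) x| ≤
          C * ((n : ℝ) ^ 4)⁻¹ * weightedNorm 4 α u := by
  have hα : α < 1 := hα1.trans_le (by rw [div_le_one (by linarith)]; linarith)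
  have hq4 : 4 ≤ q := by
    have : 4 ≤ 4 / α := by rw [le_div_iff₀ hα0]; linarith
    linarith
  have hq1 : 1 ≤ q := by linarith
  have hα4 : 4 / q ≤ α := by
    rw [gt_iff_lt, div_lt_iff₀ hα0] at hq
    rw [div_le_iff₀ (by linarith)]
    linarith
  have h24 : 4 / q = 2 / q + 2 / q := by ring
  have h2q : 0 ≤ 2 / q := by positivity
  obtain ⟨C, hC, key⟩ := key_bound p q hp0 hp1 hq4
  refine ⟨C * C * (1 / α + 2 ^ q), by positivity, ?_⟩
  intro n hn u hu hb x hx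
  obtain ⟨hN, hui, hH⟩ := base_osc hα0 hα hq1 hn hu hb
  obtain ⟨k1, k2⟩ := key n hn α _ (by linarith) hα.le (by positivity) u hui hH
  have hvi : IntegrableOn (cornerErr p q n u) (Set.Ioc 0 1) := by
    refine Integrable.of_bound (err_meas hn hq1 hui)
      (C * ((1 / α + 2 ^ q) * weightedNorm 4 α u) * ((n : ℝ) ^ 2)⁻¹) ?_
    filter_upwards [ae_restrict_mem measurableSet_Ioc] with y hy
    exact k2 y hy
  obtain ⟨_, l2⟩ := key n hn (α - 2 / q) _ (by linarith) (by linarith) (by positivity) _ hvi k1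
  refine (l2 x hx).trans (le_of_eq ?_)
  have : (n : ℝ) ≠ 0 := by positivity
  field_simp
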